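/- Let λ and μ be nonzero elements of k^c with ∑_{i=1}^c μ_i λ_i^a = 0. Then there is a well-defined injective homomorphism of left A-modules f : Au_λ → A ⊕ A determined by f(u_λ) = ( ∑_{i=1}^c μ_i λ_i q^{i−1} x_1^{a−1} ⋯ x_{i−1}^{a−1} x_{i+1}^{a−1} ⋯ x_c^{a−1}, −u_λ ), where the products of the x_n^{a−1} are taken in increasing order of the index n. -/

import Mathlib

open scoped TensorProduct

/-- The relations defining the quantum complete intersection `A^c_q`:
`x_i ^ a = 0` for all `i`, and `x_i x_j = q • x_j x_i` for `i < j`. -/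
inductive QCIRel (k : Type) [Field k] (c a : ℕ) (q : k) :
    FreeAlgebra k (Fin c) → FreeAlgebra k (Fin c) → Prop
  | pow (i : Fin c) : QCIRel k c a q (FreeAlgebra.ι k i ^ a) 0
  | comm (i j : Fin c) (hij : i < j) :
      QCIRel k c a q (FreeAlgebra.ι k i * FreeAlgebra.ι k j)
        (q • (FreeAlgebra.ι k j * FreeAlgebra.ι k i))

/-- The quantum complete intersection algebra `A^c_q = k⟨x_1,…,x_c⟩/(x_i^a, x_ix_j - q x_jx_i)`. -/
def QCI (k : Type) [Field k] (c a : ℕ) (q : k) : Type := RingQuot (QCIRel k c a q)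

noncomputable instance (k : Type) [Field k] (c a : ℕ) (q : k) : Ring (QCI k c a q) :=
  inferInstanceAs (Ring (RingQuot (QCIRel k c a q)))

noncomputable instance (k : Type) [Field k] (c a : ℕ) (q : k) : Algebra k (QCI k c a q) :=
  inferInstanceAs (Algebra k (RingQuot (QCIRel k c a q)))

namespace QCI

variable (k : Type) [Field k] (c a : ℕ) (q : k)

/-- The generators `x_i` of the quantum complete intersection. -/
noncomputable def x (i : Fin c) : QCI k c a q :=
  RingQuot.mkAlgHom k (QCIRel k c a q) (FreeAlgebra.ι k i)

/-- The element `u_λ = λ_1 x_1 + ⋯ + λ_c x_c` of `A^c_q`. -/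
noncomputable def u (lam : Fin c → k) : QCI k c a q :=
  ∑ i, lam i • QCI.x k c a q i

end QCI

/-- `a' = a / gcd(a, char k)` if `char k > 0`, and `a' = a` if `char k = 0`. -/
noncomputable def aprime (k : Type) [Field k] (a : ℕ) : ℕ :=
  if ringChar k > 0 then a / Nat.gcd a (ringChar k) else a

theorem aprime_dvd (k : Type) [Field k] (a : ℕ) : aprime k a ∣ a := by
  unfold aprime
  split_ifs
  · exact Nat.div_dvd_of_dvd (Nat.gcd_dvd_left _ _)
  · exact dvd_rfl

/-- If `a = 2b > 0`, the `b`-th power of a primitive `a'`-th root of unity is `-1`. -/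
theorem pow_half_eq_neg_one {k : Type} [Field k] {b : ℕ} (hb : 0 < b) {q : k}
    (hq : IsPrimitiveRoot q (aprime k (2 * b))) : q ^ b = -1 := by
  have hsq : (q ^ b) ^ 2 = 1 := by
    rw [← pow_mul, mul_comm, hq.pow_eq_one_iff_dvd]
    exact aprime_dvd k _
  by_contra hne
  have hone : q ^ b = 1 := (sq_eq_sq_iff_eq_or_eq_neg.1 (hsq.trans (one_pow 2).symm)).resolve_right hne
  have h1 := (hq.pow_eq_one_iff_dvd b).1 hone
  have hlt : ¬ 2 * b ∣ b := fun hd => by have := Nat.le_of_dvd hb hd; omega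
  unfold aprime at h1 hq
  split_ifs at h1 hq with hp
  · have hprime : (ringChar k).Prime :=
      (CharP.char_is_prime_or_zero k (ringChar k)).resolve_right hp.ne'
    rcases (Nat.dvd_prime hprime).1 (Nat.gcd_dvd_right (2 * b) (ringChar k)) with hg | hg
    · rw [hg, Nat.div_one] at h1
      exact hlt h1
    · have hdvd : ringChar k ∣ 2 * b := hg ▸ Nat.gcd_dvd_left _ _
      rw [hg] at h1
      obtain ⟨d, hd⟩ := h1
      have hmul := Nat.div_mul_cancel hdvd
      have hpd : ringChar k = d * 2 := by
        refine Nat.eq_of_mul_eq_mul_left (Nat.div_pos (Nat.le_of_dvd (by omega) hdvd) hp) ?_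
        rw [hmul, ← mul_assoc, ← hd, mul_comm]
      have h2 : ringChar k = 2 :=
        ((Nat.prime_dvd_prime_iff_eq Nat.prime_two hprime).1 ⟨d, by rw [hpd, mul_comm]⟩).symm
      have htwo : (2 : k) = 0 := by
        have := CharP.cast_eq_zero k (ringChar k)
        rwa [h2, Nat.cast_ofNat] at this
      exact hne (hone.trans (by linear_combination htwo))
  · exact hlt h1

/-- The sign identity `q^{a(a-1)/2} = (-1)^{a-1}`. -/
theorem pow_sum_range_eq {k : Type} [Field k] {a : ℕ} (ha : 0 < a) {q : k}
    (hq : IsPrimitiveRoot q (aprime k a)) :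
    q ^ (∑ t ∈ Finset.range a, t) = (-1) ^ (a - 1) := by
  have hqa : q ^ a = 1 := (hq.pow_eq_one_iff_dvd a).2 (aprime_dvd k a)
  have hT := Finset.sum_range_id_mul_two a
  rcases Nat.even_or_odd' a with ⟨b, rfl | rfl⟩
  · have hT' : ∑ t ∈ Finset.range (2 * b), t = b * (2 * b - 1) := by
      rw [mul_assoc] at hT; omega
    rw [hT', pow_mul, pow_half_eq_neg_one (by omega) hq]
  · have hT' : ∑ t ∈ Finset.range (2 * b + 1), t = (2 * b + 1) * b := by
      rw [Nat.add_sub_cancel, mul_comm 2 b, ← mul_assoc, mul_comm b 2] at hT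
      omega
    rw [hT', pow_mul, hqa, one_pow, Nat.add_sub_cancel, pow_mul]
    simp

section OrderedMonomial

variable {k A : Type*} [Field k] [Ring A] [Algebra k A]

/-- The ordered monomial `x_1^{e_1} ⋯ x_c^{e_c}`. -/
def orderedMonomial {c : ℕ} (x : Fin c → A) (e : Fin c → ℕ) : A :=
  (List.ofFn fun n => x n ^ e n).prod

theorem orderedMonomial_succ {c : ℕ} (x : Fin (c + 1) → A) (e : Fin (c + 1) → ℕ) :
    orderedMonomial x e =
      x 0 ^ e 0 * orderedMonomial (fun n => x n.succ) (fun n => e n.succ) := by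
  simp [orderedMonomial, List.ofFn_succ]

theorem mul_pow_of_qcomm {q : k} (hq0 : q ≠ 0) {y z : A} (h : y * z = q • (z * y)) (m : ℕ) :
    z * y ^ m = (q⁻¹) ^ m • (y ^ m * z) := by
  have h' : z * y = q⁻¹ • (y * z) := by rw [h, inv_smul_smul₀ hq0]
  induction m with
  | zero => simp
  | succ m ih =>
    rw [pow_succ y, ← mul_assoc, ih, smul_mul_assoc, mul_assoc, h', mul_smul_comm, smul_smul,
      ← pow_succ, mul_assoc]

/-- Left multiplication of an ordered monomial by a generator. -/
theorem mul_orderedMonomial {q : k} (hq0 : q ≠ 0) {c : ℕ} (x : Fin c → A)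
    (hx : ∀ i j, i < j → x i * x j = q • (x j * x i)) (e : Fin c → ℕ) (n : Fin c) :
    x n * orderedMonomial x e =
      (q⁻¹) ^ (∑ m, if m < n then e m else 0) •
        orderedMonomial x (Function.update e n (e n + 1)) := by
  induction c with
  | zero => exact n.elim0
  | succ c ih =>
    rw [orderedMonomial_succ, orderedMonomial_succ x (Function.update _ _ _)]
    refine Fin.cases ?_ (fun n => ?_) n
    · simp [← mul_assoc, pow_succ']
    · have hu : (fun m : Fin c => Function.update e n.succ (e n.succ + 1) m.succ) =
          Function.update (fun m => e m.succ) n (e n.succ + 1) := by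
        ext m
        simp [Function.update_apply]
      rw [← mul_assoc, mul_pow_of_qcomm hq0 (hx 0 n.succ n.succ_pos), smul_mul_assoc, mul_assoc,
        ih (fun m => x m.succ) (fun i j hij => hx _ _ (Fin.succ_lt_succ_iff.2 hij)), hu,
        mul_smul_comm, smul_smul, ← pow_add, Fin.sum_univ_succ]
      simp [(Fin.succ_ne_zero n).symm]

theorem orderedMonomial_eq_zero {c a : ℕ} (x : Fin c → A) (hx : ∀ i, x i ^ a = 0)
    (e : Fin c → ℕ) (n : Fin c) (hn : a ≤ e n) : orderedMonomial x e = 0 := by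
  rw [orderedMonomial]
  refine List.prod_eq_zero ?_
  rw [List.mem_ofFn]
  exact ⟨n, pow_eq_zero_of_le hn (hx n)⟩

/-- The exponent vector with entry `r` at `i`, entry `s` at `j`, and `b` elsewhere. -/
def twoExp {c : ℕ} (b : ℕ) (i j : Fin c) (r s : ℕ) (n : Fin c) : ℕ :=
  if n = i then r else if n = j then s else b

variable {c a : ℕ} {i j : Fin c}

theorem sum_twoExp_left (hij : i < j) (b r s : ℕ) :
    (∑ n, if n < i then twoExp b i j r s n else 0) = b * i := by
  have : ∀ n, (if n < i then twoExp b i j r s n else 0) = if n < i then b else 0 := by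
    intro n
    unfold twoExp
    grind
  simp_rw [this]
  rw [← Finset.sum_filter]
  simp [mul_comm, Finset.filter_gt_eq_Iio]

theorem sum_twoExp_right (hij : i < j) (b r s : ℕ) :
    (∑ n, if n < j then twoExp b i j r s n else 0) + b = b * j + r := by
  have : ∀ n, (if n < j then twoExp b i j r s n else 0) + (if n = i then b else 0) =
      (if n < j then b else 0) + (if n = i then r else 0) := by
    intro n
    unfold twoExp
    grind
  have h := Finset.sum_congr (rfl : (Finset.univ : Finset (Fin c)) = _) fun n _ => this n
  rw [Finset.sum_add_distrib, Finset.sum_add_distrib, Finset.sum_ite_eq' _ i,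
    Finset.sum_ite_eq' _ i, ← Finset.sum_filter (s := Finset.univ) (p := (· < j)) (f := fun _ => b)] at h
  simpa [mul_comm, Finset.filter_gt_eq_Iio] using h

theorem linear_mul_orderedMonomial {q : k} (ha : 1 ≤ a) (hqa : q ^ a = 1) (x : Fin c → A)
    (hx : ∀ i j, i < j → x i * x j = q • (x j * x i)) (hpow : ∀ i, x i ^ a = 0)
    (lam : Fin c → k) (hij : i < j) (r s : ℕ) :
    q ^ (r + 1) • ((∑ n, lam n • x n) * orderedMonomial x (twoExp (a - 1) i j r s)) =
      (lam i * q ^ ((i : ℕ) + 1 + r)) • orderedMonomial x (twoExp (a - 1) i j (r + 1) s) +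
      (lam j * q ^ (j : ℕ)) • orderedMonomial x (twoExp (a - 1) i j r (s + 1)) := by
  have hq0 : q ≠ 0 := by
    rintro rfl
    rw [zero_pow (by omega)] at hqa
    exact zero_ne_one hqa
  have hinv : (q⁻¹) ^ (a - 1) = q := by
    have : q ^ (a - 1) * q = 1 := by rw [← pow_succ, Nat.sub_add_cancel ha, hqa]
    rw [inv_pow, inv_eq_of_mul_eq_one_right this]
  have hi : (q⁻¹) ^ (∑ n, if n < i then twoExp (a - 1) i j r s n else 0) = q ^ (i : ℕ) := by
    rw [sum_twoExp_left hij, pow_mul, hinv]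
  have hj : q ^ (r + 1) * (q⁻¹) ^ (∑ n, if n < j then twoExp (a - 1) i j r s n else 0) =
      q ^ (j : ℕ) := by
    have h := congrArg ((q⁻¹) ^ ·) (sum_twoExp_right hij (a - 1) r s)
    simp only [pow_add, pow_mul, hinv] at h
    rw [pow_succ, mul_assoc, mul_comm q, h, inv_pow]
    field_simp
  have hui : Function.update (twoExp (a - 1) i j r s) i (twoExp (a - 1) i j r s i + 1) =
      twoExp (a - 1) i j (r + 1) s := by
    ext n
    simp only [Function.update_apply, twoExp]
    grind
  have huj : Function.update (twoExp (a - 1) i j r s) j (twoExp (a - 1) i j r s j + 1) =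
      twoExp (a - 1) i j r (s + 1) := by
    ext n
    simp only [Function.update_apply, twoExp]
    grind
  rw [Finset.sum_mul, Finset.sum_eq_add_of_mem i j (Finset.mem_univ _) (Finset.mem_univ _) hij.ne]
  · rw [smul_mul_assoc, smul_mul_assoc, mul_orderedMonomial hq0 x hx, mul_orderedMonomial hq0 x hx,
      hui, huj, hi, smul_add, smul_smul, smul_smul, smul_smul, smul_smul, ← hj]
    congr 2 <;> ring
  · rintro n - ⟨hni, hnj⟩
    rw [smul_mul_assoc, mul_orderedMonomial hq0 x hx,
      orderedMonomial_eq_zero x hpow _ n, smul_zero, smul_zero]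
    simp [twoExp, hni, hnj]
    omega

/-- The ordered product `x_1^{a-1} ⋯ x_c^{a-1}` with the `i`-th factor omitted. -/
def omitMonomial (a : ℕ) (x : Fin c → A) (i : Fin c) : A :=
  (List.ofFn fun n : Fin c => if n = i then 1 else x n ^ (a - 1)).prod

theorem orderedMonomial_twoExp_zero_left (x : Fin c → A) :
    orderedMonomial x (twoExp (a - 1) i j 0 (a - 1)) = omitMonomial a x i := by
  unfold orderedMonomial omitMonomial twoExp
  congr 2
  ext n
  split_ifs <;> simp

theorem orderedMonomial_twoExp_zero_right (hij : i ≠ j) (x : Fin c → A) :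
    orderedMonomial x (twoExp (a - 1) i j (a - 1) 0) = omitMonomial a x j := by
  unfold orderedMonomial omitMonomial twoExp
  congr 2
  ext n
  split_ifs <;> simp_all

theorem map_omitMonomial_of_lt {q : k} (ha : 1 ≤ a) (hqa : q ^ a = 1)
    (hsign : q ^ (∑ t ∈ Finset.range a, t) = (-1) ^ (a - 1)) (x : Fin c → A)
    (hx : ∀ i j, i < j → x i * x j = q • (x j * x i)) (hpow : ∀ i, x i ^ a = 0)
    (lam : Fin c → k) {V : Type*} [AddCommGroup V] [Module k V] (π : A →ₗ[k] V)
    (hπ : ∀ z, π ((∑ n, lam n • x n) * z) = 0) (hij : i < j) :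
    (lam i ^ (a - 1) * q ^ (j : ℕ)) • π (omitMonomial a x j) =
      (lam j ^ (a - 1) * q ^ (i : ℕ)) • π (omitMonomial a x i) := by
  have step : ∀ m ≤ a - 1,
      (lam i ^ m * q ^ (((i : ℕ) + 1) * m + ∑ t ∈ Finset.range m, t)) •
          π (orderedMonomial x (twoExp (a - 1) i j m (a - 1 - m))) =
        ((-lam j) ^ m * q ^ ((j : ℕ) * m)) • π (omitMonomial a x i) := by
    intro m
    induction m with
    | zero => simp [orderedMonomial_twoExp_zero_left]
    | succ m ih =>
      intro hm
      have h := congrArg π (linear_mul_orderedMonomial ha hqa x hx hpow lam hij m (a - 1 - (m + 1)))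
      rw [map_smul, hπ, smul_zero, map_add, map_smul, map_smul,
        show a - 1 - (m + 1) + 1 = a - 1 - m by omega] at h
      have h' := eq_neg_of_add_eq_zero_left h.symm
      have ih' := ih (by omega)
      calc _ = (lam i ^ m * q ^ (((i : ℕ) + 1) * m + ∑ t ∈ Finset.range m, t)) •
            ((lam i * q ^ ((i : ℕ) + 1 + m)) •
              π (orderedMonomial x (twoExp (a - 1) i j (m + 1) (a - 1 - (m + 1))))) := by
              rw [smul_smul, Finset.sum_range_succ]
              congr 1
              ring
        _ = (-(lam j * q ^ (j : ℕ))) •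
            ((lam i ^ m * q ^ (((i : ℕ) + 1) * m + ∑ t ∈ Finset.range m, t)) •
              π (orderedMonomial x (twoExp (a - 1) i j m (a - 1 - m)))) := by
              rw [h', ← neg_smul, smul_comm]
        _ = _ := by
              rw [ih', smul_smul]
              congr 1
              ring
  have h := step (a - 1) le_rfl
  rw [Nat.sub_self, orderedMonomial_twoExp_zero_right hij.ne] at h
  obtain ⟨b, rfl⟩ : ∃ b, a = b + 1 := ⟨a - 1, by omega⟩
  simp only [Nat.add_sub_cancel] at h hsign ⊢
  have hone : ((-1 : k) ^ b) * (-1) ^ b = 1 := by rw [← mul_pow]; simp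
  have hl : lam i ^ b * q ^ (j : ℕ) = ((-1) ^ b * q ^ ((i : ℕ) + j)) *
      (lam i ^ b * q ^ (((i : ℕ) + 1) * b + ∑ t ∈ Finset.range b, t)) := by
    have : q ^ ((i : ℕ) + j) * q ^ (((i : ℕ) + 1) * b + ∑ t ∈ Finset.range b, t) =
        q ^ (j : ℕ) * (-1) ^ b := by
      rw [← hsign, Finset.sum_range_succ]
      calc _ = (q ^ (b + 1)) ^ (i : ℕ) * (q ^ (j : ℕ) * q ^ (∑ t ∈ Finset.range b, t + b)) := by ring
        _ = _ := by rw [hqa, one_pow, one_mul]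
    linear_combination (-lam i ^ b * (-1) ^ b) * this - lam i ^ b * q ^ (j : ℕ) * hone
  have hr : lam j ^ b * q ^ (i : ℕ) = ((-1) ^ b * q ^ ((i : ℕ) + j)) *
      ((-lam j) ^ b * q ^ ((j : ℕ) * b)) := by
    have : q ^ ((i : ℕ) + j) * q ^ ((j : ℕ) * b) = q ^ (i : ℕ) := by
      calc _ = (q ^ (b + 1)) ^ (j : ℕ) * q ^ (i : ℕ) := by ring
        _ = _ := by rw [hqa, one_pow, one_mul]
    rw [neg_pow]
    linear_combination (-lam j ^ b * (-1) ^ b * (-1) ^ b) * this - lam j ^ b * q ^ (i : ℕ) * hone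
  rw [hl, hr, mul_smul, h, ← mul_smul]

theorem map_omitMonomial {q : k} (ha : 1 ≤ a) (hqa : q ^ a = 1)
    (hsign : q ^ (∑ t ∈ Finset.range a, t) = (-1) ^ (a - 1)) (x : Fin c → A)
    (hx : ∀ i j, i < j → x i * x j = q • (x j * x i)) (hpow : ∀ i, x i ^ a = 0)
    (lam : Fin c → k) {V : Type*} [AddCommGroup V] [Module k V] (π : A →ₗ[k] V)
    (hπ : ∀ z, π ((∑ n, lam n • x n) * z) = 0) (i j : Fin c) :
    (lam i ^ (a - 1) * q ^ (j : ℕ)) • π (omitMonomial a x j) =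
      (lam j ^ (a - 1) * q ^ (i : ℕ)) • π (omitMonomial a x i) := by
  rcases lt_trichotomy i j with hij | rfl | hij
  · exact map_omitMonomial_of_lt ha hqa hsign x hx hpow lam π hπ hij
  · rfl
  · exact (map_omitMonomial_of_lt ha hqa hsign x hx hpow lam π hπ hij).symm

/-- The first component of `f(u_λ)` is a right multiple of `u_λ`. -/
theorem exists_linear_mul_eq {q : k} (ha : 1 ≤ a) (hqa : q ^ a = 1)
    (hsign : q ^ (∑ t ∈ Finset.range a, t) = (-1) ^ (a - 1)) (x : Fin c → A)
    (hx : ∀ i j, i < j → x i * x j = q • (x j * x i)) (hpow : ∀ i, x i ^ a = 0)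
    (lam mu : Fin c → k) (hlam : lam ≠ 0) (h : ∑ i, mu i * lam i ^ a = 0) :
    ∃ y, (∑ n, lam n • x n) * y =
      ∑ i, (mu i * lam i * q ^ (i : ℕ)) • omitMonomial a x i := by
  obtain ⟨j, hj⟩ := Function.ne_iff.1 hlam
  rw [Pi.zero_apply] at hj
  set R := LinearMap.range (LinearMap.mulLeft k (∑ n, lam n • x n))
  have hπ : ∀ z, R.mkQ ((∑ n, lam n • x n) * z) = 0 := fun z =>
    (Submodule.Quotient.mk_eq_zero R).2 ⟨z, rfl⟩
  suffices hmem : R.mkQ (∑ i, (mu i * lam i * q ^ (i : ℕ)) • omitMonomial a x i) = 0 from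
    (Submodule.Quotient.mk_eq_zero R).1 hmem
  have hc : lam j ^ (a - 1) ≠ 0 := pow_ne_zero _ hj
  refine (smul_eq_zero.1 ?_).resolve_left hc
  rw [map_sum, Finset.smul_sum]
  calc _ = ∑ i, (mu i * lam i ^ a) • (q ^ (j : ℕ) • R.mkQ (omitMonomial a x j)) := by
        refine Finset.sum_congr rfl fun i _ => ?_
        have hij := map_omitMonomial ha hqa hsign x hx hpow lam R.mkQ hπ i j
        calc _ = (mu i * lam i) •
              ((lam j ^ (a - 1) * q ^ (i : ℕ)) • R.mkQ (omitMonomial a x i)) := by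
              rw [map_smul, smul_smul, smul_smul]
              congr 1
              ring
          _ = _ := by
              rw [← hij, smul_smul, smul_smul, ← Nat.sub_add_cancel ha, Nat.add_sub_cancel]
              congr 1
              ring
    _ = 0 := by rw [← Finset.sum_smul, h, zero_smul]

end OrderedMonomial

namespace QCI

variable (k : Type) [Field k] (c a : ℕ) (q : k)

theorem x_pow (i : Fin c) : x k c a q i ^ a = 0 := by
  have h := RingQuot.mkAlgHom_rel k (QCIRel.pow (a := a) (q := q) i)
  rw [map_pow, map_zero] at h
  exact h

theorem x_mul_x (i j : Fin c) (hij : i < j) :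
    x k c a q i * x k c a q j = q • (x k c a q j * x k c a q i) := by
  have h := RingQuot.mkAlgHom_rel k (QCIRel.comm (a := a) (q := q) i j hij)
  rw [map_smul, map_mul, map_mul] at h
  exact h

end QCI

/-- Let `λ, μ ∈ k^c` be nonzero with `∑ μ_i λ_i^a = 0`. Then there is a well-defined injective
homomorphism of left `A`-modules `f : Au_λ → A ⊕ A` determined by
`f(u_λ) = (∑_i μ_i λ_i q^{i-1} x_1^{a-1} ⋯ x_{i-1}^{a-1} x_{i+1}^{a-1} ⋯ x_c^{a-1}, -u_λ)`. -/
theorem exists_injective_hom_of_orthogonal (k : Type) [Field k] [IsAlgClosed k] (a c : ℕ)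
    (ha : 2 ≤ a) (hc : 1 ≤ c) (q : k) (hq : IsPrimitiveRoot q (aprime k a))
    (lam mu : Fin c → k) (hlam : lam ≠ 0) (hmu : mu ≠ 0)
    (h : ∑ i : Fin c, mu i * lam i ^ a = 0) :
    ∃ f : (Submodule.span (QCI k c a q) {QCI.u k c a q lam}) →ₗ[QCI k c a q]
        (QCI k c a q × QCI k c a q),
      Function.Injective f ∧
      f ⟨QCI.u k c a q lam, Submodule.mem_span_singleton_self _⟩ =
        (∑ i : Fin c, (mu i * lam i * q ^ (i : ℕ)) •
            (List.ofFn fun n : Fin c =>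
              if n = i then 1 else QCI.x k c a q n ^ (a - 1)).prod,
          - QCI.u k c a q lam) := by
  have hqa : q ^ a = 1 := (hq.pow_eq_one_iff_dvd a).2 (aprime_dvd k a)
  obtain ⟨y, hy⟩ := exists_linear_mul_eq (by omega) hqa (pow_sum_range_eq (by omega) hq)
    (QCI.x k c a q) (QCI.x_mul_x k c a q) (QCI.x_pow k c a q) lam mu hlam h
  refine ⟨((LinearMap.toSpanSingleton _ _ y).prod (-LinearMap.id)).comp (Submodule.subtype _),
    fun v w hvw => ?_, ?_⟩
  · exact Subtype.ext (neg_injective (congrArg Prod.snd hvw))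
  · exact Prod.ext hy rfl
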